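/- Let p ≥ 2 and let w : Ω → ℝ be a C² function on an open set Ω ⊂ ℝⁿ. Define H_p(ξ) = |ξ|^((p-2)/2) ξ. Then at every point where Dw ≠ 0, |D²w|² |Dw|^(p-2) ≤ |D(H_p(Dw))|² ≤ (p²/4) |D²w|² |Dw|^(p-2). -/

import Mathlib

open Real EuclideanSpace

theorem Hp_alg {E : Type*} [NormedAddCommGroup E] [InnerProductSpace ℝ E] (g u : E) (hg : g ≠ 0)
    (a c : ℝ) (ha : 0 ≤ a) :
    c ^ 2 * ‖u‖ ^ 2 ≤ ‖c • u + (a * (c / ‖g‖ ^ 2) * inner ℝ g u) • g‖ ^ 2 ∧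
    ‖c • u + (a * (c / ‖g‖ ^ 2) * inner ℝ g u) • g‖ ^ 2 ≤ (1 + a) ^ 2 * (c ^ 2 * ‖u‖ ^ 2) := by
  have hs : 0 < ‖g‖ ^ 2 := by positivity
  have key : ‖c • u + (a * (c / ‖g‖ ^ 2) * inner ℝ g u) • g‖ ^ 2
      = c ^ 2 * ‖u‖ ^ 2 + (2 * a + a ^ 2) * c ^ 2 * ((inner ℝ g u) ^ 2 / ‖g‖ ^ 2) := by
    rw [norm_add_sq_real, norm_smul, norm_smul, mul_pow, mul_pow, Real.norm_eq_abs,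
      Real.norm_eq_abs, sq_abs, sq_abs, real_inner_smul_left, real_inner_smul_right,
      real_inner_comm]
    field_simp
    ring
  have hcs : (inner ℝ g u) ^ 2 / ‖g‖ ^ 2 ≤ ‖u‖ ^ 2 := by
    rw [div_le_iff₀ hs]
    have := abs_real_inner_le_norm g u
    calc (inner ℝ g u) ^ 2 = |inner ℝ g u| ^ 2 := (sq_abs _).symm
      _ ≤ (‖g‖ * ‖u‖) ^ 2 := by gcongr
      _ = _ := by ring
  have hk : 0 ≤ (2 * a + a ^ 2) * c ^ 2 := by positivity
  rw [key]
  constructor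
  · have : 0 ≤ (2 * a + a ^ 2) * c ^ 2 * ((inner ℝ g u) ^ 2 / ‖g‖ ^ 2) := by positivity
    linarith
  · have := mul_le_mul_of_nonneg_left hcs hk
    nlinarith

theorem Hp_deriv {E F : Type*} [NormedAddCommGroup E] [NormedSpace ℝ E]
    [NormedAddCommGroup F] [InnerProductSpace ℝ F] (G : E → F) (x : E) (A : E →L[ℝ] F)
    (hG : HasFDerivAt G A x) (h0 : G x ≠ 0) (a : ℝ) :
    ∃ B : E →L[ℝ] F, HasFDerivAt (fun y => ‖G y‖ ^ a • G y) B x ∧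
      ∀ v, B v = ‖G x‖ ^ a • A v +
        (a * (‖G x‖ ^ a / ‖G x‖ ^ 2) * inner ℝ (G x) (A v)) • G x := by
  have hs : 0 < ‖G x‖ ^ 2 := by positivity
  have e : ∀ y, ‖G y‖ ^ a = (‖G y‖ ^ 2) ^ (a / 2) := by
    intro y
    rw [← Real.rpow_natCast, ← Real.rpow_mul (norm_nonneg _)]
    congr 1
    push_cast
    ring
  have h1 := (hG.norm_sq.rpow_const (p := a / 2) (Or.inl hs.ne')).smul hG
  have h2 : (fun y => ‖G y‖ ^ a • G y) = (fun y => (‖G y‖ ^ 2) ^ (a / 2)) • G := by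
    funext y
    rw [e]
    rfl
  refine ⟨_, h2 ▸ h1, ?_⟩
  · intro v
    rw [e, Real.rpow_sub_one hs.ne']
    simp
    congr 1
    ring

theorem Hp_grad_diff {n : ℕ} (w : EuclideanSpace ℝ (Fin n) → ℝ) (x : EuclideanSpace ℝ (Fin n))
    (hw : ContDiffAt ℝ 2 w x) : DifferentiableAt ℝ (gradient w) x := by
  have h : DifferentiableAt ℝ (fderiv ℝ w) x :=
    (hw.fderiv_right (m := 1) (by norm_num)).differentiableAt (by norm_num)
  let L : StrongDual ℝ (EuclideanSpace ℝ (Fin n)) →L[ℝ] EuclideanSpace ℝ (Fin n) :=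
    { toFun := fun f => (InnerProductSpace.toDual ℝ (EuclideanSpace ℝ (Fin n))).symm f
      map_add' := fun f g => map_add _ f g
      map_smul' := fun c f => by simp
      cont := (InnerProductSpace.toDual ℝ (EuclideanSpace ℝ (Fin n))).symm.continuous }
  exact L.differentiableAt.comp x h

theorem Hp_coord {n : ℕ} (G : EuclideanSpace ℝ (Fin n) → EuclideanSpace ℝ (Fin n))
    (x : EuclideanSpace ℝ (Fin n)) (A : EuclideanSpace ℝ (Fin n) →L[ℝ] EuclideanSpace ℝ (Fin n))
    (hG : HasFDerivAt G A x) :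
    (∑ i : Fin n, ∑ j : Fin n, (fderiv ℝ (fun y => G y i) x (EuclideanSpace.single j 1)) ^ 2)
      = ∑ j : Fin n, ‖A (EuclideanSpace.single j 1)‖ ^ 2 := by
  have h : ∀ i, fderiv ℝ (fun y => G y i) x
      = (EuclideanSpace.proj (𝕜 := ℝ) i : EuclideanSpace ℝ (Fin n) →L[ℝ] ℝ).comp A := by
    intro i
    exact ((EuclideanSpace.proj (𝕜 := ℝ) i
      : EuclideanSpace ℝ (Fin n) →L[ℝ] ℝ).hasFDerivAt.comp x hG).fderiv
  rw [Finset.sum_comm]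
  refine Finset.sum_congr rfl fun j _ => ?_
  rw [EuclideanSpace.real_norm_sq_eq]
  refine Finset.sum_congr rfl fun i _ => ?_
  rw [h i]
  rfl

/-- Pointwise comparison between the Frobenius norm of `D(H_p(Dw))` and
`|D²w|² |Dw|^{p-2}`, where `H_p(ξ) = |ξ|^{(p-2)/2} ξ`, at points where `Dw ≠ 0`. -/
theorem Hp_gradient_comparison (n : ℕ) (p : ℝ) (hp : 2 ≤ p)
    (Ω : Set (EuclideanSpace ℝ (Fin n))) (hΩ : IsOpen Ω)
    (w : EuclideanSpace ℝ (Fin n) → ℝ)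
    (hw : ∀ x ∈ Ω, ContDiffAt ℝ 2 w x)
    (x : EuclideanSpace ℝ (Fin n)) (hx : x ∈ Ω) (hx0 : gradient w x ≠ 0) :
    (∑ i : Fin n, ∑ j : Fin n,
        (fderiv ℝ (fun y => gradient w y i) x (EuclideanSpace.single j 1)) ^ 2)
        * ‖gradient w x‖ ^ (p - 2)
      ≤ ∑ i : Fin n, ∑ j : Fin n,
          (fderiv ℝ (fun y => (‖gradient w y‖ ^ ((p - 2) / 2) • gradient w y) i) x
            (EuclideanSpace.single j 1)) ^ 2 ∧
    (∑ i : Fin n, ∑ j : Fin n,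
        (fderiv ℝ (fun y => (‖gradient w y‖ ^ ((p - 2) / 2) • gradient w y) i) x
          (EuclideanSpace.single j 1)) ^ 2)
      ≤ p ^ 2 / 4 *
          ((∑ i : Fin n, ∑ j : Fin n,
            (fderiv ℝ (fun y => gradient w y i) x (EuclideanSpace.single j 1)) ^ 2)
            * ‖gradient w x‖ ^ (p - 2)) := by
  have hG := (Hp_grad_diff w x (hw x hx)).hasFDerivAt
  obtain ⟨B, hB, hBv⟩ := Hp_deriv _ x _ hG hx0 ((p - 2) / 2)
  have hc : ‖gradient w x‖ ^ (p - 2) = (‖gradient w x‖ ^ ((p - 2) / 2)) ^ 2 := by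
    rw [← Real.rpow_natCast, ← Real.rpow_mul (norm_nonneg _)]
    congr 1
    push_cast
    ring
  have hp2 : p ^ 2 / 4 = (1 + (p - 2) / 2) ^ 2 := by ring
  rw [Hp_coord _ x _ hG, Hp_coord _ x _ hB, hc, hp2, Finset.sum_mul, Finset.mul_sum]
  have ha : 0 ≤ (p - 2) / 2 := by linarith
  constructor
  · refine Finset.sum_le_sum fun j _ => ?_
    rw [hBv, mul_comm]
    exact (Hp_alg _ _ hx0 _ _ ha).1
  · refine Finset.sum_le_sum fun j _ => ?_
    rw [hBv, mul_comm (‖_‖ ^ 2)]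
    exact (Hp_alg _ _ hx0 _ _ ha).2
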